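/- Let Ω ⊆ ℝ^n be open and let φ be a classical phase function on Ω×ℝ^p: φ is smooth on Ω×(ℝ^p∖0), real-valued, positively homogeneous of degree 1 in θ, and ∇_{y,θ}φ(y,θ) ≠ 0 for all (y,θ) ∈ Ω×(ℝ^p∖0). Let C_φ := {(y,θ) ∈ Ω×(ℝ^p∖0) : ∇_θφ(y,θ) = 0} and let W ⊆ C_φ be a closed conic subset. If (x₀,ξ₀) ∈ Ω×(ℝ^n∖0) satisfies (x₀,ξ₀) ∉ {(y, ∇_yφ(y,θ)) : (y,θ) ∈ W}, then there exist a relatively compact open neighborhood U ⊆ Ω of x₀, an open conic neighborhood Γ ⊆ ℝ^n∖0 of ξ₀, an open conic neighborhood V ⊆ Ω×(ℝ^p∖0) of W, and a constant c > 0 such that |ξ − ∇_yφ(y,θ)| ≥ c (|ξ| + |θ|) for all y ∈ U, all ξ ∈ Γ, and all (y,θ) ∈ V with y ∈ U. -/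

import Mathlib

open MeasureTheory Set
open scoped BigOperators Topology Real

noncomputable section

/-- `Euc d` is `d`-dimensional Euclidean space. -/
abbrev Euc (d : ℕ) : Type := EuclideanSpace ℝ (Fin d)

/-- Directional derivative of `f` in direction `v`. -/
def dirD {E F : Type*} [NormedAddCommGroup E] [NormedSpace ℝ E]
    [NormedAddCommGroup F] [NormedSpace ℝ F] (v : E) (f : E → F) : E → F :=
  fun x => fderiv ℝ f x v

/-- Iterated directional derivatives along a list of directions. -/
def dirDs {E F : Type*} [NormedAddCommGroup E] [NormedSpace ℝ E]
    [NormedAddCommGroup F] [NormedSpace ℝ F] (L : List E) (f : E → F) : E → F :=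
  L.foldr dirD f

/-- ⟨ξ⟩ = (1+|ξ|²)^{1/2}. -/
def jb {d : ℕ} (ξ : Euc d) : ℝ := Real.sqrt (1 + ‖ξ‖ ^ 2)

/-- Basis direction in the first (`y`) block. -/
def eY {n p : ℕ} (k : Fin n) : Euc n × Euc p := (EuclideanSpace.single k 1, 0)

/-- Basis direction in the second (`ξ`) block. -/
def eXi {n p : ℕ} (j : Fin p) : Euc n × Euc p := (0, EuclideanSpace.single j 1)

def eX3 {q n p : ℕ} (i : Fin q) : Euc q × Euc n × Euc p := (EuclideanSpace.single i 1, 0, 0)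
def eY3 {q n p : ℕ} (k : Fin n) : Euc q × Euc n × Euc p := (0, EuclideanSpace.single k 1, 0)
def eXi3 {q n p : ℕ} (j : Fin p) : Euc q × Euc n × Euc p := (0, 0, EuclideanSpace.single j 1)

/-- basis directions of `Euc d` indexed by a list of coordinates -/
def basisL {d : ℕ} (L : List (Fin d)) : List (Euc d) :=
  L.map (fun i => EuclideanSpace.single i 1)

/-- |∇_{y,ξ}φ|² as a sum of squares of partial derivatives. -/
def gradSq {n p : ℕ} (φ : Euc n × Euc p → ℝ) (z : Euc n × Euc p) : ℝ :=
  (∑ k : Fin n, (dirD (eY k) φ z) ^ 2) + ∑ j : Fin p, (dirD (eXi j) φ z) ^ 2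

/-- |∇_ξ φ|². -/
def gradXiSq {n p : ℕ} (φ : Euc n × Euc p → ℝ) (z : Euc n × Euc p) : ℝ :=
  ∑ j : Fin p, (dirD (eXi j) φ z) ^ 2

/-- ∇_y φ as a vector in `Euc n`. -/
def gradY {n p : ℕ} (φ : Euc n × Euc p → ℝ) (z : Euc n × Euc p) : Euc n :=
  (EuclideanSpace.equiv (Fin n) ℝ).symm (fun k => dirD (eY k) φ z)

/-- |∇_{y,ξ}φ|² in the three-block setting (gradient w.r.t. `(y,ξ)` only). -/
def gradSq3 {q n p : ℕ} (φ : Euc q × Euc n × Euc p → ℝ) (z : Euc q × Euc n × Euc p) : ℝ :=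
  (∑ k : Fin n, (dirD (eY3 k) φ z) ^ 2) + ∑ j : Fin p, (dirD (eXi3 j) φ z) ^ 2

/-- slow scale net -/
def SlowScale (s : ℝ → ℝ) : Prop :=
  (∀ ε ∈ Set.Ioc (0:ℝ) 1, 0 < s ε) ∧
  ∀ q : ℕ, ∃ c > 0, ∀ ε ∈ Set.Ioc (0:ℝ) 1, s ε ^ q ≤ c / ε

/-- Moderate net in S^m_{ρ,δ}(Ω×ℝ^p): smoothness, membership, moderate bounds. -/
def SymbModerate {n p : ℕ} (Ω : Set (Euc n)) (m ρ δ : ℝ)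
    (a : ℝ → Euc n × Euc p → ℂ) : Prop :=
  (∀ ε ∈ Set.Ioc (0:ℝ) 1, ContDiffOn ℝ (⊤ : ℕ∞) (a ε) (Ω ×ˢ (univ : Set (Euc p)))) ∧
  (∀ ε ∈ Set.Ioc (0:ℝ) 1, ∀ K ⊆ Ω, IsCompact K → ∀ (α : List (Fin p)) (β : List (Fin n)),
    ∃ C : ℝ, ∀ y ∈ K, ∀ ξ : Euc p,
      jb ξ ^ (-m + ρ * (α.length : ℝ) - δ * (β.length : ℝ)) *
        ‖dirDs (α.map eXi ++ β.map eY) (a ε) (y, ξ)‖ ≤ C) ∧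
  ∀ K ⊆ Ω, IsCompact K → ∀ (α : List (Fin p)) (β : List (Fin n)),
    ∃ N : ℕ, ∃ C > 0, ∃ η ∈ Set.Ioc (0:ℝ) 1, ∀ ε ∈ Set.Ioc (0:ℝ) η, ∀ y ∈ K, ∀ ξ : Euc p,
      jb ξ ^ (-m + ρ * (α.length : ℝ) - δ * (β.length : ℝ)) *
        ‖dirDs (α.map eXi ++ β.map eY) (a ε) (y, ξ)‖ ≤ C * ε ^ (-(N : ℤ))

/-- Negligible net in S^m_{ρ,δ}(Ω×ℝ^p). -/
def SymbNegligible {n p : ℕ} (Ω : Set (Euc n)) (m ρ δ : ℝ)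
    (a : ℝ → Euc n × Euc p → ℂ) : Prop :=
  (∀ ε ∈ Set.Ioc (0:ℝ) 1, ContDiffOn ℝ (⊤ : ℕ∞) (a ε) (Ω ×ˢ (univ : Set (Euc p)))) ∧
  (∀ ε ∈ Set.Ioc (0:ℝ) 1, ∀ K ⊆ Ω, IsCompact K → ∀ (α : List (Fin p)) (β : List (Fin n)),
    ∃ C : ℝ, ∀ y ∈ K, ∀ ξ : Euc p,
      jb ξ ^ (-m + ρ * (α.length : ℝ) - δ * (β.length : ℝ)) *
        ‖dirDs (α.map eXi ++ β.map eY) (a ε) (y, ξ)‖ ≤ C) ∧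
  ∀ K ⊆ Ω, IsCompact K → ∀ (α : List (Fin p)) (β : List (Fin n)), ∀ q : ℕ,
    ∃ C > 0, ∃ η ∈ Set.Ioc (0:ℝ) 1, ∀ ε ∈ Set.Ioc (0:ℝ) η, ∀ y ∈ K, ∀ ξ : Euc p,
      jb ξ ^ (-m + ρ * (α.length : ℝ) - δ * (β.length : ℝ)) *
        ‖dirDs (α.map eXi ++ β.map eY) (a ε) (y, ξ)‖ ≤ C * ε ^ q

/-- Regular net in S^m_{ρ,δ}(Ω×ℝ^p): one N works for all derivatives on each compact set. -/
def SymbRegular {n p : ℕ} (Ω : Set (Euc n)) (m ρ δ : ℝ)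
    (a : ℝ → Euc n × Euc p → ℂ) : Prop :=
  (∀ ε ∈ Set.Ioc (0:ℝ) 1, ContDiffOn ℝ (⊤ : ℕ∞) (a ε) (Ω ×ˢ (univ : Set (Euc p)))) ∧
  (∀ ε ∈ Set.Ioc (0:ℝ) 1, ∀ K ⊆ Ω, IsCompact K → ∀ (α : List (Fin p)) (β : List (Fin n)),
    ∃ C : ℝ, ∀ y ∈ K, ∀ ξ : Euc p,
      jb ξ ^ (-m + ρ * (α.length : ℝ) - δ * (β.length : ℝ)) *
        ‖dirDs (α.map eXi ++ β.map eY) (a ε) (y, ξ)‖ ≤ C) ∧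
  ∀ K ⊆ Ω, IsCompact K → ∃ N : ℕ, ∀ (α : List (Fin p)) (β : List (Fin n)),
    ∃ C > 0, ∃ η ∈ Set.Ioc (0:ℝ) 1, ∀ ε ∈ Set.Ioc (0:ℝ) η, ∀ y ∈ K, ∀ ξ : Euc p,
      jb ξ ^ (-m + ρ * (α.length : ℝ) - δ * (β.length : ℝ)) *
        ‖dirDs (α.map eXi ++ β.map eY) (a ε) (y, ξ)‖ ≤ C * ε ^ (-(N : ℤ))

/-- Moderate net in S^m_hg(Ω×ℝ^p∖0) (F-valued, positively homogeneous symbols). -/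
def HgModerate {n p : ℕ} {F : Type*} [NormedAddCommGroup F] [NormedSpace ℝ F]
    (Ω : Set (Euc n)) (m : ℝ) (φ : ℝ → Euc n × Euc p → F) : Prop :=
  ∀ K ⊆ Ω, IsCompact K → ∀ (α : List (Fin p)) (β : List (Fin n)),
    ∃ N : ℕ, ∃ C > 0, ∃ η ∈ Set.Ioc (0:ℝ) 1, ∀ ε ∈ Set.Ioc (0:ℝ) η, ∀ y ∈ K,
      ∀ ξ : Euc p, ξ ≠ 0 →
      ‖ξ‖ ^ (-m + (α.length : ℝ)) *
        ‖dirDs (α.map eXi ++ β.map eY) (φ ε) (y, ξ)‖ ≤ C * ε ^ (-(N : ℤ))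

/-- Negligible net in S^m_hg(Ω×ℝ^p∖0). -/
def HgNegligible {n p : ℕ} {F : Type*} [NormedAddCommGroup F] [NormedSpace ℝ F]
    (Ω : Set (Euc n)) (m : ℝ) (φ : ℝ → Euc n × Euc p → F) : Prop :=
  ∀ K ⊆ Ω, IsCompact K → ∀ (α : List (Fin p)) (β : List (Fin n)), ∀ q : ℕ,
    ∃ C > 0, ∃ η ∈ Set.Ioc (0:ℝ) 1, ∀ ε ∈ Set.Ioc (0:ℝ) η, ∀ y ∈ K,
      ∀ ξ : Euc p, ξ ≠ 0 →
      ‖ξ‖ ^ (-m + (α.length : ℝ)) *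
        ‖dirDs (α.map eXi ++ β.map eY) (φ ε) (y, ξ)‖ ≤ C * ε ^ q

/-- Net of phase functions on Ω×ℝ^p. -/
def IsPhaseNet {n p : ℕ} (Ω : Set (Euc n)) (φ : ℝ → Euc n × Euc p → ℝ) : Prop :=
  ∀ ε ∈ Set.Ioc (0:ℝ) 1,
    ContDiffOn ℝ (⊤ : ℕ∞) (φ ε) (Ω ×ˢ {ξ : Euc p | ξ ≠ 0}) ∧
    (∀ y ∈ Ω, ∀ ξ : Euc p, ξ ≠ 0 → ∀ t : ℝ, 0 < t → φ ε (y, t • ξ) = t * φ ε (y, ξ)) ∧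
    (∀ y ∈ Ω, ∀ ξ : Euc p, ξ ≠ 0 → gradSq (φ ε) (y, ξ) ≠ 0)

/-- The set M_Φ(Ω×ℝ^p) of moderate nets of phase functions with strictly nonzero gradient. -/
def MPhi {n p : ℕ} (Ω : Set (Euc n)) (φ : ℝ → Euc n × Euc p → ℝ) : Prop :=
  IsPhaseNet Ω φ ∧ HgModerate Ω 1 φ ∧
  ∀ K ⊆ Ω, IsCompact K → ∃ r > (0:ℝ), ∃ η ∈ Set.Ioc (0:ℝ) 1, ∀ ε ∈ Set.Ioc (0:ℝ) η,
    ∀ y ∈ K, ∀ ξ : Euc p, ξ ≠ 0 → ε ^ r ≤ gradSq (φ ε) (y, ‖ξ‖⁻¹ • ξ)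

/-- Slow scale moderateness in S^m_hg. -/
def HgSlowScale {n p : ℕ} {F : Type*} [NormedAddCommGroup F] [NormedSpace ℝ F]
    (Ω : Set (Euc n)) (m : ℝ) (φ : ℝ → Euc n × Euc p → F) : Prop :=
  ∀ K ⊆ Ω, IsCompact K → ∀ (α : List (Fin p)) (β : List (Fin n)),
    ∃ s : ℝ → ℝ, SlowScale s ∧ ∃ η ∈ Set.Ioc (0:ℝ) 1, ∀ ε ∈ Set.Ioc (0:ℝ) η, ∀ y ∈ K,
      ∀ ξ : Euc p, ξ ≠ 0 →
      ‖ξ‖ ^ (-m + (α.length : ℝ)) *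
        ‖dirDs (α.map eXi ++ β.map eY) (φ ε) (y, ξ)‖ ≤ s ε

/-- Slow scale nets of phase functions M_{Φ,sc}(Ω×ℝ^p). -/
def MPhiSc {n p : ℕ} (Ω : Set (Euc n)) (φ : ℝ → Euc n × Euc p → ℝ) : Prop :=
  IsPhaseNet Ω φ ∧ HgSlowScale Ω 1 φ ∧
  ∀ K ⊆ Ω, IsCompact K → ∃ s : ℝ → ℝ, SlowScale s ∧ ∃ η ∈ Set.Ioc (0:ℝ) 1,
    ∀ ε ∈ Set.Ioc (0:ℝ) η, ∀ y ∈ K, ∀ ξ : Euc p, ξ ≠ 0 →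
      (s ε)⁻¹ ≤ gradSq (φ ε) (y, ‖ξ‖⁻¹ • ξ)

/-- cut-off function equal to 1 for |ξ|<1/4 and 0 for |ξ|>1/2. -/
def IsCutoff {p : ℕ} (χ : Euc p → ℝ) : Prop :=
  ContDiff ℝ (⊤ : ℕ∞) χ ∧ (∀ ξ : Euc p, ‖ξ‖ < 1/4 → χ ξ = 1) ∧ (∀ ξ : Euc p, 1/2 < ‖ξ‖ → χ ξ = 0)

/-- 1/|∇_{y,ξ}φ(y,ξ/|ξ|)|². -/
def varphiN {n p : ℕ} (φ : Euc n × Euc p → ℝ) (z : Euc n × Euc p) : ℝ :=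
  (gradSq φ (z.1, ‖z.2‖⁻¹ • z.2))⁻¹

def coefA {n p : ℕ} (χ : Euc p → ℝ) (φ : Euc n × Euc p → ℝ) (j : Fin p) :
    Euc n × Euc p → ℂ :=
  fun z => Complex.I * (((1 - χ z.2) * varphiN φ z * dirD (eXi j) φ z : ℝ) : ℂ)

def coefB {n p : ℕ} (χ : Euc p → ℝ) (φ : Euc n × Euc p → ℝ) (k : Fin n) :
    Euc n × Euc p → ℂ :=
  fun z => Complex.I * (((1 - χ z.2) * (‖z.2‖ ^ 2)⁻¹ * varphiN φ z * dirD (eY k) φ z : ℝ) : ℂ)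

def coefC {n p : ℕ} (χ : Euc p → ℝ) (φ : Euc n × Euc p → ℝ) : Euc n × Euc p → ℂ :=
  fun z => ((χ z.2 : ℝ) : ℂ) + (∑ j : Fin p, dirD (eXi j) (coefA χ φ j) z)
    + ∑ k : Fin n, dirD (eY k) (coefB χ φ k) z

/-- The operator L_φ. -/
def Lop {n p : ℕ} (χ : Euc p → ℝ) (φ : Euc n × Euc p → ℝ) (f : Euc n × Euc p → ℂ) :
    Euc n × Euc p → ℂ :=
  fun z => (∑ j : Fin p, coefA χ φ j z * dirD (eXi j) f z)
    + (∑ k : Fin n, coefB χ φ k z * dirD (eY k) f z) + coefC χ φ z * f z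

/-- Moderate nets of smooth functions E_M(Ω). -/
def EMod {d : ℕ} (Ω : Set (Euc d)) (v : ℝ → Euc d → ℂ) : Prop :=
  (∀ ε ∈ Set.Ioc (0:ℝ) 1, ContDiffOn ℝ (⊤ : ℕ∞) (v ε) Ω) ∧
  ∀ K ⊆ Ω, IsCompact K → ∀ L : List (Fin d),
    ∃ N : ℕ, ∃ C > 0, ∃ η ∈ Set.Ioc (0:ℝ) 1, ∀ ε ∈ Set.Ioc (0:ℝ) η, ∀ x ∈ K,
      ‖dirDs (basisL L) (v ε) x‖ ≤ C * ε ^ (-(N : ℤ))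

/-- Regular nets of smooth functions E^∞_M(Ω). -/
def EModInf {d : ℕ} (Ω : Set (Euc d)) (v : ℝ → Euc d → ℂ) : Prop :=
  (∀ ε ∈ Set.Ioc (0:ℝ) 1, ContDiffOn ℝ (⊤ : ℕ∞) (v ε) Ω) ∧
  ∀ K ⊆ Ω, IsCompact K → ∃ N : ℕ, ∀ L : List (Fin d),
    ∃ C > 0, ∃ η ∈ Set.Ioc (0:ℝ) 1, ∀ ε ∈ Set.Ioc (0:ℝ) η, ∀ x ∈ K,
      ‖dirDs (basisL L) (v ε) x‖ ≤ C * ε ^ (-(N : ℤ))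

/-- Moderate net in S^m_{ρ,δ}(Ω'×Ω×ℝ^p). -/
def Symb3Moderate {q n p : ℕ} (Ω' : Set (Euc q)) (Ω : Set (Euc n)) (m ρ δ : ℝ)
    (a : ℝ → Euc q × Euc n × Euc p → ℂ) : Prop :=
  (∀ ε ∈ Set.Ioc (0:ℝ) 1, ContDiffOn ℝ (⊤ : ℕ∞) (a ε) (Ω' ×ˢ Ω ×ˢ (univ : Set (Euc p)))) ∧
  (∀ ε ∈ Set.Ioc (0:ℝ) 1, ∀ K' ⊆ Ω', IsCompact K' → ∀ K ⊆ Ω, IsCompact K →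
    ∀ (α : List (Fin p)) (βx : List (Fin q)) (βy : List (Fin n)),
    ∃ C : ℝ, ∀ x ∈ K', ∀ y ∈ K, ∀ ξ : Euc p,
      jb ξ ^ (-m + ρ * (α.length : ℝ) - δ * ((βx.length + βy.length : ℕ) : ℝ)) *
        ‖dirDs (α.map eXi3 ++ βx.map eX3 ++ βy.map eY3) (a ε) (x, y, ξ)‖ ≤ C) ∧
  ∀ K' ⊆ Ω', IsCompact K' → ∀ K ⊆ Ω, IsCompact K →
    ∀ (α : List (Fin p)) (βx : List (Fin q)) (βy : List (Fin n)),
    ∃ N : ℕ, ∃ C > 0, ∃ η ∈ Set.Ioc (0:ℝ) 1, ∀ ε ∈ Set.Ioc (0:ℝ) η,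
      ∀ x ∈ K', ∀ y ∈ K, ∀ ξ : Euc p,
      jb ξ ^ (-m + ρ * (α.length : ℝ) - δ * ((βx.length + βy.length : ℕ) : ℝ)) *
        ‖dirDs (α.map eXi3 ++ βx.map eX3 ++ βy.map eY3) (a ε) (x, y, ξ)‖ ≤ C * ε ^ (-(N : ℤ))

/-- Regular net in S^m_{ρ,δ}(Ω'×Ω×ℝ^p). -/
def Symb3Regular {q n p : ℕ} (Ω' : Set (Euc q)) (Ω : Set (Euc n)) (m ρ δ : ℝ)
    (a : ℝ → Euc q × Euc n × Euc p → ℂ) : Prop :=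
  (∀ ε ∈ Set.Ioc (0:ℝ) 1, ContDiffOn ℝ (⊤ : ℕ∞) (a ε) (Ω' ×ˢ Ω ×ˢ (univ : Set (Euc p)))) ∧
  (∀ ε ∈ Set.Ioc (0:ℝ) 1, ∀ K' ⊆ Ω', IsCompact K' → ∀ K ⊆ Ω, IsCompact K →
    ∀ (α : List (Fin p)) (βx : List (Fin q)) (βy : List (Fin n)),
    ∃ C : ℝ, ∀ x ∈ K', ∀ y ∈ K, ∀ ξ : Euc p,
      jb ξ ^ (-m + ρ * (α.length : ℝ) - δ * ((βx.length + βy.length : ℕ) : ℝ)) *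
        ‖dirDs (α.map eXi3 ++ βx.map eX3 ++ βy.map eY3) (a ε) (x, y, ξ)‖ ≤ C) ∧
  ∀ K' ⊆ Ω', IsCompact K' → ∀ K ⊆ Ω, IsCompact K → ∃ N : ℕ,
    ∀ (α : List (Fin p)) (βx : List (Fin q)) (βy : List (Fin n)),
    ∃ C > 0, ∃ η ∈ Set.Ioc (0:ℝ) 1, ∀ ε ∈ Set.Ioc (0:ℝ) η,
      ∀ x ∈ K', ∀ y ∈ K, ∀ ξ : Euc p,
      jb ξ ^ (-m + ρ * (α.length : ℝ) - δ * ((βx.length + βy.length : ℕ) : ℝ)) *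
        ‖dirDs (α.map eXi3 ++ βx.map eX3 ++ βy.map eY3) (a ε) (x, y, ξ)‖ ≤ C * ε ^ (-(N : ℤ))

/-- Moderate net of order −∞ on Ω'×Ω×ℝ^p. -/
def Smoothing3Moderate {q n p : ℕ} (Ω' : Set (Euc q)) (Ω : Set (Euc n))
    (a : ℝ → Euc q × Euc n × Euc p → ℂ) : Prop :=
  (∀ ε ∈ Set.Ioc (0:ℝ) 1, ContDiffOn ℝ (⊤ : ℕ∞) (a ε) (Ω' ×ˢ Ω ×ˢ (univ : Set (Euc p)))) ∧
  (∀ ε ∈ Set.Ioc (0:ℝ) 1, ∀ m : ℝ, ∀ K' ⊆ Ω', IsCompact K' → ∀ K ⊆ Ω, IsCompact K →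
    ∀ (α : List (Fin p)) (βx : List (Fin q)) (βy : List (Fin n)),
    ∃ C : ℝ, ∀ x ∈ K', ∀ y ∈ K, ∀ ξ : Euc p,
      jb ξ ^ (-m + (α.length : ℝ)) *
        ‖dirDs (α.map eXi3 ++ βx.map eX3 ++ βy.map eY3) (a ε) (x, y, ξ)‖ ≤ C) ∧
  ∀ m : ℝ, ∀ K' ⊆ Ω', IsCompact K' → ∀ K ⊆ Ω, IsCompact K →
    ∀ (α : List (Fin p)) (βx : List (Fin q)) (βy : List (Fin n)),
    ∃ N : ℕ, ∃ C > 0, ∃ η ∈ Set.Ioc (0:ℝ) 1, ∀ ε ∈ Set.Ioc (0:ℝ) η,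
      ∀ x ∈ K', ∀ y ∈ K, ∀ ξ : Euc p,
      jb ξ ^ (-m + (α.length : ℝ)) *
        ‖dirDs (α.map eXi3 ++ βx.map eX3 ++ βy.map eY3) (a ε) (x, y, ξ)‖ ≤ C * ε ^ (-(N : ℤ))

/-- Regular net of order −∞ on Ω'×Ω×ℝ^p. -/
def Smoothing3Regular {q n p : ℕ} (Ω' : Set (Euc q)) (Ω : Set (Euc n))
    (a : ℝ → Euc q × Euc n × Euc p → ℂ) : Prop :=
  (∀ ε ∈ Set.Ioc (0:ℝ) 1, ContDiffOn ℝ (⊤ : ℕ∞) (a ε) (Ω' ×ˢ Ω ×ˢ (univ : Set (Euc p)))) ∧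
  (∀ ε ∈ Set.Ioc (0:ℝ) 1, ∀ m : ℝ, ∀ K' ⊆ Ω', IsCompact K' → ∀ K ⊆ Ω, IsCompact K →
    ∀ (α : List (Fin p)) (βx : List (Fin q)) (βy : List (Fin n)),
    ∃ C : ℝ, ∀ x ∈ K', ∀ y ∈ K, ∀ ξ : Euc p,
      jb ξ ^ (-m + (α.length : ℝ)) *
        ‖dirDs (α.map eXi3 ++ βx.map eX3 ++ βy.map eY3) (a ε) (x, y, ξ)‖ ≤ C) ∧
  ∀ K' ⊆ Ω', IsCompact K' → ∀ K ⊆ Ω, IsCompact K → ∃ N : ℕ, ∀ m : ℝ,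
    ∀ (α : List (Fin p)) (βx : List (Fin q)) (βy : List (Fin n)),
    ∃ C > 0, ∃ η ∈ Set.Ioc (0:ℝ) 1, ∀ ε ∈ Set.Ioc (0:ℝ) η,
      ∀ x ∈ K', ∀ y ∈ K, ∀ ξ : Euc p,
      jb ξ ^ (-m + (α.length : ℝ)) *
        ‖dirDs (α.map eXi3 ++ βx.map eX3 ++ βy.map eY3) (a ε) (x, y, ξ)‖ ≤ C * ε ^ (-(N : ℤ))

/-- Nets of phase functions with parameter x ∈ Ω'. -/
def IsPhaseNet3 {q n p : ℕ} (Ω' : Set (Euc q)) (Ω : Set (Euc n))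
    (φ : ℝ → Euc q × Euc n × Euc p → ℝ) : Prop :=
  ∀ ε ∈ Set.Ioc (0:ℝ) 1,
    ContinuousOn (φ ε) (Ω' ×ˢ Ω ×ˢ (univ : Set (Euc p))) ∧
    ContDiffOn ℝ (⊤ : ℕ∞) (φ ε) (Ω' ×ˢ Ω ×ˢ {ξ : Euc p | ξ ≠ 0}) ∧
    (∀ x ∈ Ω', ∀ y ∈ Ω, ∀ ξ : Euc p, ξ ≠ 0 → ∀ t : ℝ, 0 < t →
      φ ε (x, y, t • ξ) = t * φ ε (x, y, ξ)) ∧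
    (∀ x ∈ Ω', ∀ y ∈ Ω, ∀ ξ : Euc p, ξ ≠ 0 → gradSq3 (φ ε) (x, y, ξ) ≠ 0)

/-- S^1_hg-moderateness in all variables for parametrized phase nets. -/
def Hg3Moderate {q n p : ℕ} (Ω' : Set (Euc q)) (Ω : Set (Euc n)) (m : ℝ)
    (φ : ℝ → Euc q × Euc n × Euc p → ℝ) : Prop :=
  ∀ K' ⊆ Ω', IsCompact K' → ∀ K ⊆ Ω, IsCompact K →
    ∀ (α : List (Fin p)) (βx : List (Fin q)) (βy : List (Fin n)),
    ∃ N : ℕ, ∃ C > 0, ∃ η ∈ Set.Ioc (0:ℝ) 1, ∀ ε ∈ Set.Ioc (0:ℝ) η,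
      ∀ x ∈ K', ∀ y ∈ K, ∀ ξ : Euc p, ξ ≠ 0 →
      ‖ξ‖ ^ (-m + (α.length : ℝ)) *
        ‖dirDs (α.map eXi3 ++ βx.map eX3 ++ βy.map eY3) (φ ε) (x, y, ξ)‖ ≤ C * ε ^ (-(N : ℤ))

def Hg3SlowScale {q n p : ℕ} (Ω' : Set (Euc q)) (Ω : Set (Euc n)) (m : ℝ)
    (φ : ℝ → Euc q × Euc n × Euc p → ℝ) : Prop :=
  ∀ K' ⊆ Ω', IsCompact K' → ∀ K ⊆ Ω, IsCompact K →
    ∀ (α : List (Fin p)) (βx : List (Fin q)) (βy : List (Fin n)),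
    ∃ s : ℝ → ℝ, SlowScale s ∧ ∃ η ∈ Set.Ioc (0:ℝ) 1, ∀ ε ∈ Set.Ioc (0:ℝ) η,
      ∀ x ∈ K', ∀ y ∈ K, ∀ ξ : Euc p, ξ ≠ 0 →
      ‖ξ‖ ^ (-m + (α.length : ℝ)) *
        ‖dirDs (α.map eXi3 ++ βx.map eX3 ++ βy.map eY3) (φ ε) (x, y, ξ)‖ ≤ s ε

/-- M_Φ(Ω';Ω×ℝ^p). -/
def MPhi3 {q n p : ℕ} (Ω' : Set (Euc q)) (Ω : Set (Euc n))
    (φ : ℝ → Euc q × Euc n × Euc p → ℝ) : Prop :=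
  IsPhaseNet3 Ω' Ω φ ∧ Hg3Moderate Ω' Ω 1 φ ∧
  ∀ K' ⊆ Ω', IsCompact K' → ∀ K ⊆ Ω, IsCompact K →
    ∃ r > (0:ℝ), ∃ η ∈ Set.Ioc (0:ℝ) 1, ∀ ε ∈ Set.Ioc (0:ℝ) η,
      ∀ x ∈ K', ∀ y ∈ K, ∀ ξ : Euc p, ξ ≠ 0 →
        ε ^ r ≤ gradSq3 (φ ε) (x, y, ‖ξ‖⁻¹ • ξ)

/-- M_{Φ,sc}(Ω';Ω×ℝ^p). -/
def MPhi3Sc {q n p : ℕ} (Ω' : Set (Euc q)) (Ω : Set (Euc n))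
    (φ : ℝ → Euc q × Euc n × Euc p → ℝ) : Prop :=
  IsPhaseNet3 Ω' Ω φ ∧ Hg3SlowScale Ω' Ω 1 φ ∧
  ∀ K' ⊆ Ω', IsCompact K' → ∀ K ⊆ Ω, IsCompact K →
    ∃ s : ℝ → ℝ, SlowScale s ∧ ∃ η ∈ Set.Ioc (0:ℝ) 1, ∀ ε ∈ Set.Ioc (0:ℝ) η,
      ∀ x ∈ K', ∀ y ∈ K, ∀ ξ : Euc p, ξ ≠ 0 →
        (s ε)⁻¹ ≤ gradSq3 (φ ε) (x, y, ‖ξ‖⁻¹ • ξ)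

def varphiN3 {q n p : ℕ} (φ : Euc q × Euc n × Euc p → ℝ) (z : Euc q × Euc n × Euc p) : ℝ :=
  (gradSq3 φ (z.1, z.2.1, ‖z.2.2‖⁻¹ • z.2.2))⁻¹

def coefA3 {q n p : ℕ} (χ : Euc p → ℝ) (φ : Euc q × Euc n × Euc p → ℝ) (j : Fin p) :
    Euc q × Euc n × Euc p → ℂ :=
  fun z => Complex.I * (((1 - χ z.2.2) * varphiN3 φ z * dirD (eXi3 j) φ z : ℝ) : ℂ)

def coefB3 {q n p : ℕ} (χ : Euc p → ℝ) (φ : Euc q × Euc n × Euc p → ℝ) (k : Fin n) :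
    Euc q × Euc n × Euc p → ℂ :=
  fun z => Complex.I * (((1 - χ z.2.2) * (‖z.2.2‖ ^ 2)⁻¹ * varphiN3 φ z * dirD (eY3 k) φ z : ℝ) : ℂ)

def coefC3 {q n p : ℕ} (χ : Euc p → ℝ) (φ : Euc q × Euc n × Euc p → ℝ) :
    Euc q × Euc n × Euc p → ℂ :=
  fun z => ((χ z.2.2 : ℝ) : ℂ) + (∑ j : Fin p, dirD (eXi3 j) (coefA3 χ φ j) z)
    + ∑ k : Fin n, dirD (eY3 k) (coefB3 χ φ k) z

/-- The operator L_φ(x;y,ξ,∂_y,∂_ξ). -/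
def Lop3 {q n p : ℕ} (χ : Euc p → ℝ) (φ : Euc q × Euc n × Euc p → ℝ)
    (f : Euc q × Euc n × Euc p → ℂ) : Euc q × Euc n × Euc p → ℂ :=
  fun z => (∑ j : Fin p, coefA3 χ φ j z * dirD (eXi3 j) f z)
    + (∑ k : Fin n, coefB3 χ φ k z * dirD (eY3 k) f z) + coefC3 χ φ z * f z


/-- Moderate net of order −∞ on Ω×ℝ^p. -/
def SmoothingModerate {n p : ℕ} (Ω : Set (Euc n)) (a : ℝ → Euc n × Euc p → ℂ) : Prop :=
  (∀ ε ∈ Set.Ioc (0:ℝ) 1, ContDiffOn ℝ (⊤ : ℕ∞) (a ε) (Ω ×ˢ (univ : Set (Euc p)))) ∧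
  (∀ ε ∈ Set.Ioc (0:ℝ) 1, ∀ m : ℝ, ∀ K ⊆ Ω, IsCompact K →
    ∀ (α : List (Fin p)) (β : List (Fin n)),
    ∃ C : ℝ, ∀ y ∈ K, ∀ ξ : Euc p,
      jb ξ ^ (-m + (α.length : ℝ)) *
        ‖dirDs (α.map eXi ++ β.map eY) (a ε) (y, ξ)‖ ≤ C) ∧
  ∀ m : ℝ, ∀ K ⊆ Ω, IsCompact K → ∀ (α : List (Fin p)) (β : List (Fin n)),
    ∃ N : ℕ, ∃ C > 0, ∃ η ∈ Set.Ioc (0:ℝ) 1, ∀ ε ∈ Set.Ioc (0:ℝ) η, ∀ y ∈ K, ∀ ξ : Euc p,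
      jb ξ ^ (-m + (α.length : ℝ)) *
        ‖dirDs (α.map eXi ++ β.map eY) (a ε) (y, ξ)‖ ≤ C * ε ^ (-(N : ℤ))

/-- Regular net of order −∞ on Ω×ℝ^p. -/
def SmoothingRegular {n p : ℕ} (Ω : Set (Euc n)) (a : ℝ → Euc n × Euc p → ℂ) : Prop :=
  (∀ ε ∈ Set.Ioc (0:ℝ) 1, ContDiffOn ℝ (⊤ : ℕ∞) (a ε) (Ω ×ˢ (univ : Set (Euc p)))) ∧
  (∀ ε ∈ Set.Ioc (0:ℝ) 1, ∀ m : ℝ, ∀ K ⊆ Ω, IsCompact K →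
    ∀ (α : List (Fin p)) (β : List (Fin n)),
    ∃ C : ℝ, ∀ y ∈ K, ∀ ξ : Euc p,
      jb ξ ^ (-m + (α.length : ℝ)) *
        ‖dirDs (α.map eXi ++ β.map eY) (a ε) (y, ξ)‖ ≤ C) ∧
  ∀ K ⊆ Ω, IsCompact K → ∃ N : ℕ, ∀ m : ℝ, ∀ (α : List (Fin p)) (β : List (Fin n)),
    ∃ C > 0, ∃ η ∈ Set.Ioc (0:ℝ) 1, ∀ ε ∈ Set.Ioc (0:ℝ) η, ∀ y ∈ K, ∀ ξ : Euc p,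
      jb ξ ^ (-m + (α.length : ℝ)) *
        ‖dirDs (α.map eXi ++ β.map eY) (a ε) (y, ξ)‖ ≤ C * ε ^ (-(N : ℤ))

/-- Moderate net in S^m_{ρ,δ}(V) on the conic set V = Ω×(ℝ^p∖0). -/
def ConicModerate {n p : ℕ} (Ω : Set (Euc n)) (m ρ δ : ℝ)
    (a : ℝ → Euc n × Euc p → ℂ) : Prop :=
  (∀ ε ∈ Set.Ioc (0:ℝ) 1, ContDiffOn ℝ (⊤ : ℕ∞) (a ε) (Ω ×ˢ {ξ : Euc p | ξ ≠ 0})) ∧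
  (∀ ε ∈ Set.Ioc (0:ℝ) 1, ∀ K ⊆ Ω ×ˢ {ξ : Euc p | ξ ≠ 0}, IsCompact K →
    ∀ (α : List (Fin p)) (β : List (Fin n)), ∃ C : ℝ, ∀ z ∈ K, ∀ t : ℝ, 1 ≤ t →
      jb (t • z.2) ^ (-m + ρ * (α.length : ℝ) - δ * (β.length : ℝ)) *
        ‖dirDs (α.map eXi ++ β.map eY) (a ε) (z.1, t • z.2)‖ ≤ C) ∧
  ∀ K ⊆ Ω ×ˢ {ξ : Euc p | ξ ≠ 0}, IsCompact K →
    ∀ (α : List (Fin p)) (β : List (Fin n)),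
    ∃ N : ℕ, ∃ C > 0, ∃ η ∈ Set.Ioc (0:ℝ) 1, ∀ ε ∈ Set.Ioc (0:ℝ) η, ∀ z ∈ K, ∀ t : ℝ, 1 ≤ t →
      jb (t • z.2) ^ (-m + ρ * (α.length : ℝ) - δ * (β.length : ℝ)) *
        ‖dirDs (α.map eXi ++ β.map eY) (a ε) (z.1, t • z.2)‖ ≤ C * ε ^ (-(N : ℤ))

/-- Negligible net in S^m_{ρ,δ}(V) on the conic set V = Ω×(ℝ^p∖0). -/
def ConicNegligible {n p : ℕ} (Ω : Set (Euc n)) (m ρ δ : ℝ)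
    (a : ℝ → Euc n × Euc p → ℂ) : Prop :=
  (∀ ε ∈ Set.Ioc (0:ℝ) 1, ContDiffOn ℝ (⊤ : ℕ∞) (a ε) (Ω ×ˢ {ξ : Euc p | ξ ≠ 0})) ∧
  (∀ ε ∈ Set.Ioc (0:ℝ) 1, ∀ K ⊆ Ω ×ˢ {ξ : Euc p | ξ ≠ 0}, IsCompact K →
    ∀ (α : List (Fin p)) (β : List (Fin n)), ∃ C : ℝ, ∀ z ∈ K, ∀ t : ℝ, 1 ≤ t →
      jb (t • z.2) ^ (-m + ρ * (α.length : ℝ) - δ * (β.length : ℝ)) *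
        ‖dirDs (α.map eXi ++ β.map eY) (a ε) (z.1, t • z.2)‖ ≤ C) ∧
  ∀ K ⊆ Ω ×ˢ {ξ : Euc p | ξ ≠ 0}, IsCompact K →
    ∀ (α : List (Fin p)) (β : List (Fin n)), ∀ q : ℕ,
    ∃ C > 0, ∃ η ∈ Set.Ioc (0:ℝ) 1, ∀ ε ∈ Set.Ioc (0:ℝ) η, ∀ z ∈ K, ∀ t : ℝ, 1 ≤ t →
      jb (t • z.2) ^ (-m + ρ * (α.length : ℝ) - δ * (β.length : ℝ)) *
        ‖dirDs (α.map eXi ++ β.map eY) (a ε) (z.1, t • z.2)‖ ≤ C * ε ^ q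

/-- A point (x₀,ξ₀) at which |∇_ξφ|² is invertible on a neighborhood U×Γ. -/
def InvPt {n p : ℕ} (Ω : Set (Euc n)) (φ : ℝ → Euc n × Euc p → ℝ)
    (z : Euc n × Euc p) : Prop :=
  ∃ U : Set (Euc n), IsOpen U ∧ z.1 ∈ U ∧ U ⊆ Ω ∧ IsCompact (closure U) ∧
  ∃ Γ : Set (Euc p), IsOpen Γ ∧ z.2 ∈ Γ ∧ (∀ ξ ∈ Γ, ∀ t : ℝ, 0 < t → t • ξ ∈ Γ) ∧
  ∃ r : ℝ, ∃ η ∈ Set.Ioc (0:ℝ) 1, ∀ ε ∈ Set.Ioc (0:ℝ) η, ∀ y ∈ U, ∀ ξ ∈ Γ,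
    ε ^ r ≤ gradXiSq (φ ε) (y, ξ)

/-- A point (x₀,ξ₀) at which |∇_ξφ|² is slow scale-invertible on a neighborhood U×Γ. -/
def InvPtSc {n p : ℕ} (Ω : Set (Euc n)) (φ : ℝ → Euc n × Euc p → ℝ)
    (z : Euc n × Euc p) : Prop :=
  ∃ U : Set (Euc n), IsOpen U ∧ z.1 ∈ U ∧ U ⊆ Ω ∧ IsCompact (closure U) ∧
  ∃ Γ : Set (Euc p), IsOpen Γ ∧ z.2 ∈ Γ ∧ (∀ ξ ∈ Γ, ∀ t : ℝ, 0 < t → t • ξ ∈ Γ) ∧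
  ∃ s : ℝ → ℝ, SlowScale s ∧ ∃ η ∈ Set.Ioc (0:ℝ) 1, ∀ ε ∈ Set.Ioc (0:ℝ) η, ∀ y ∈ U, ∀ ξ ∈ Γ,
    (s ε)⁻¹ ≤ gradXiSq (φ ε) (y, ξ)

/-- The set C_φ. -/
def Cphi {n p : ℕ} (Ω : Set (Euc n)) (φ : ℝ → Euc n × Euc p → ℝ) : Set (Euc n × Euc p) :=
  {z | z.1 ∈ Ω ∧ z.2 ≠ 0 ∧ ¬ InvPt Ω φ z}

/-- The set R_φ = Ω ∖ π_Ω(C_φ). -/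
def Rphi {n p : ℕ} (Ω : Set (Euc n)) (φ : ℝ → Euc n × Euc p → ℝ) : Set (Euc n) :=
  Ω \ (Prod.fst '' Cphi Ω φ)

/-- The set C^sc_φ. -/
def CphiSc {n p : ℕ} (Ω : Set (Euc n)) (φ : ℝ → Euc n × Euc p → ℝ) : Set (Euc n × Euc p) :=
  {z | z.1 ∈ Ω ∧ z.2 ≠ 0 ∧ ¬ InvPtSc Ω φ z}

/-- The set R^sc_φ = Ω ∖ π_Ω(C^sc_φ). -/
def RphiSc {n p : ℕ} (Ω : Set (Euc n)) (φ : ℝ → Euc n × Euc p → ℝ) : Set (Euc n) :=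
  Ω \ (Prod.fst '' CphiSc Ω φ)

/-- 1/|∇_ξφ(y,ξ/|ξ|)|². -/
def varphiXi {n p : ℕ} (φ : Euc n × Euc p → ℝ) (z : Euc n × Euc p) : ℝ :=
  (gradXiSq φ (z.1, ‖z.2‖⁻¹ • z.2))⁻¹

/-- The transposed regularizing operator in the ξ-variables only:
    ᵗL f = −Σ_j a_j ∂_{ξ_j} f + χ f  with a_j = i(1−χ)|∇_ξφ|⁻²∂_{ξ_j}φ. -/
def tLxi {n p : ℕ} (χ : Euc p → ℝ) (φ : Euc n × Euc p → ℝ) (f : Euc n × Euc p → ℂ) :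
    Euc n × Euc p → ℂ :=
  fun z => -(∑ j : Fin p,
      (Complex.I * (((1 - χ z.2) * varphiXi φ z * dirD (eXi j) φ z : ℝ) : ℂ)) *
        dirD (eXi j) f z)
    + ((χ z.2 : ℝ) : ℂ) * f z

/-- d_{j}(y,θ,ξ) = (ξ_j − ∂_{y_j}φ(y,θ))/|ξ−∇_yφ(y,θ)|². -/
def dj {n p : ℕ} (φ : Euc n × Euc p → ℝ) (ξ : Euc n) (j : Fin n)
    (z : Euc n × Euc p) : ℝ :=
  (ξ j - dirD (eY j) φ z) / ‖ξ - gradY φ z‖ ^ 2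

/-- ᵗL_ε f = −Σ_j d_j D_{y_j} f − Σ_j (D_{y_j} d_j) f, with D_{y_j} = −i∂_{y_j}. -/
def tLW {n p : ℕ} (φ : Euc n × Euc p → ℝ) (ξ : Euc n) (f : Euc n × Euc p → ℂ) :
    Euc n × Euc p → ℂ :=
  fun z => -(∑ j : Fin n, ((dj φ ξ j z : ℝ) : ℂ) * (-Complex.I * dirD (eY j) f z))
    - ∑ j : Fin n, (-Complex.I * ((dirD (eY j) (dj φ ξ j) z : ℝ) : ℂ)) * f z

/-- The set `Ω × (ℝ^p ∖ 0)` is open. -/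
lemma isOpen_prod_ne_zero {n p : ℕ} {Ω : Set (Euc n)} (hΩ : IsOpen Ω) :
    IsOpen (Ω ×ˢ {θ : Euc p | θ ≠ 0}) :=
  hΩ.prod isOpen_ne

lemma gradY_apply {n p : ℕ} (φ : Euc n × Euc p → ℝ) (z : Euc n × Euc p) (k : Fin n) :
    gradY φ z k = fderiv ℝ φ z (eY k) := rfl

lemma continuousOn_gradY {n p : ℕ} {φ : Euc n × Euc p → ℝ} {s : Set (Euc n × Euc p)}
    (hs : IsOpen s) (hφ : ContDiffOn ℝ (⊤ : ℕ∞) φ s) : ContinuousOn (gradY φ) s := by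
  have hd : ContinuousOn (fderiv ℝ φ) s :=
    hφ.continuousOn_fderiv_of_isOpen hs (by exact_mod_cast le_top)
  refine (EuclideanSpace.equiv (Fin n) ℝ).symm.continuous.comp_continuousOn ?_
  exact continuousOn_pi.2 fun k => hd.clm_apply continuousOn_const

/-- If `φ` is positively homogeneous of degree one in `θ`, then so is `∇_y φ`. -/
lemma gradY_smul {n p : ℕ} {Ω : Set (Euc n)} (hΩ : IsOpen Ω) {φ : Euc n × Euc p → ℝ}
    (hsm : ContDiffOn ℝ (⊤ : ℕ∞) φ (Ω ×ˢ {θ : Euc p | θ ≠ 0}))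
    (hhom : ∀ y ∈ Ω, ∀ θ : Euc p, θ ≠ 0 → ∀ t : ℝ, 0 < t → φ (y, t • θ) = t * φ (y, θ))
    {y : Euc n} (hy : y ∈ Ω) {θ : Euc p} (hθ : θ ≠ 0) {t : ℝ} (ht : 0 < t) :
    gradY φ (y, t • θ) = t • gradY φ (y, θ) := by
  have hdiff : ∀ θ' : Euc p, θ' ≠ 0 → DifferentiableAt ℝ φ (y, θ') := fun θ' hθ' =>
    (hsm.contDiffAt ((isOpen_prod_ne_zero hΩ).mem_nhds (mk_mem_prod hy hθ'))).differentiableAt (by simp)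
  let M : Euc n × Euc p →L[ℝ] Euc n × Euc p :=
    (ContinuousLinearMap.fst ℝ (Euc n) (Euc p)).prod (t • ContinuousLinearMap.snd ℝ (Euc n) (Euc p))
  have hcomp : HasFDerivAt (φ ∘ M) ((fderiv ℝ φ (y, t • θ)).comp M) (y, θ) :=
    HasFDerivAt.comp (y, θ) (hdiff _ (smul_ne_zero ht.ne' hθ)).hasFDerivAt M.hasFDerivAt
  have hscale : HasFDerivAt (φ ∘ M) (t • fderiv ℝ φ (y, θ)) (y, θ) := by
    refine ((hdiff θ hθ).hasFDerivAt.const_smul t).congr_of_eventuallyEq ?_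
    filter_upwards [(isOpen_prod_ne_zero hΩ).mem_nhds ⟨hy, hθ⟩] with z hz
    exact hhom z.1 hz.1 z.2 hz.2 t ht
  ext k
  have hM : M (eY k) = eY k := by simp [M, eY]
  have h := DFunLike.congr_fun (hcomp.unique hscale) (eY k)
  rw [ContinuousLinearMap.comp_apply, hM] at h
  simpa [gradY_apply] using h

lemma gradY_ne_zero {n p : ℕ} {φ : Euc n × Euc p → ℝ} {z : Euc n × Euc p}
    (h : gradSq φ z ≠ 0) (hXi : gradXiSq φ z = 0) : gradY φ z ≠ 0 := by
  intro h0
  refine h ?_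
  have hY : ∀ k : Fin n, dirD (eY k) φ z = 0 := fun k => by
    simpa [gradY_apply, dirD] using congrArg (fun v : Euc n => v k) h0
  have hXi' : ∑ j : Fin p, dirD (eXi j) φ z ^ 2 = 0 := hXi
  simp [gradSq, hY, hXi']

/-- Vectors separated by cones around the unit vector `e` satisfy a reverse triangle inequality. -/
lemma mul_add_norm_le_norm_sub {E : Type*} [NormedAddCommGroup E] [InnerProductSpace ℝ E]
    {e v w : E} (he : ‖e‖ = 1) {a b : ℝ} (ha : 0 ≤ a) (hab : a ≤ b) (hb : b ≤ 1)
    (hv : b * ‖v‖ ≤ inner ℝ v e) (hw : inner ℝ w e ≤ a * ‖w‖) :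
    (b - a) / 4 * (‖v‖ + ‖w‖) ≤ ‖v - w‖ := by
  have h1 : inner ℝ v e - inner ℝ w e ≤ ‖v - w‖ := by
    simpa [inner_sub_left, he] using real_inner_le_norm (v - w) e
  have h2 : ‖w‖ - ‖v‖ ≤ ‖v - w‖ := by
    simpa [norm_sub_rev] using norm_sub_norm_le w v
  have h3 := mul_le_mul_of_nonneg_left h2 ha
  have h4 := mul_le_mul_of_nonneg_left h2 (ha.trans hab)
  have h5 := mul_le_mul_of_nonneg_right hb (norm_nonneg (v - w))
  have h6 := mul_le_mul_of_nonneg_right (hab.trans hb) (norm_nonneg (v - w))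
  linarith

/-- A compact set whose points over `x₀` satisfy an open condition satisfies it over a ball
around `x₀`. -/
lemma exists_forall_closedBall_of_isCompact {X Y : Type*} [MetricSpace X] [TopologicalSpace Y]
    {K : Set (X × Y)} (hK : IsCompact K) {f : X × Y → ℝ} (hf : ContinuousOn f K) {x₀ : X}
    (h : ∀ y, (x₀, y) ∈ K → 0 < f (x₀, y)) {R : ℝ} (hR : 0 < R) :
    ∃ r > 0, r ≤ R ∧ ∀ z ∈ K, z.1 ∈ Metric.closedBall x₀ r → 0 < f z := by
  have hB : IsCompact (K ∩ f ⁻¹' Iic 0) := by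
    obtain ⟨u, hu, huK⟩ := continuousOn_iff_isClosed.1 hf (Iic 0) isClosed_Iic
    rw [inter_comm, huK]
    exact hK.inter_left hu
  have hx₀ : x₀ ∉ Prod.fst '' (K ∩ f ⁻¹' Iic 0) := by
    rintro ⟨⟨x, y⟩, ⟨hzK, hz⟩, rfl⟩
    exact (h y hzK).not_ge hz
  obtain ⟨r, hr, hrB⟩ := Metric.nhds_basis_closedBall.mem_iff.1
    ((hB.image continuous_fst).isClosed.isOpen_compl.mem_nhds hx₀)
  refine ⟨min r R, lt_min hr hR, min_le_right _ _, fun z hz hzr => ?_⟩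
  by_contra! hfz
  exact hrB (Metric.closedBall_subset_closedBall (min_le_left _ _) hzr) ⟨z, ⟨hz, hfz⟩, rfl⟩

/-- A relatively closed subset of `Ω × (ℝ^p ∖ 0)` is compact over a compact subset of `Ω` times the
unit sphere. -/
lemma isCompact_inter_prod_sphere {n p : ℕ} {Ω : Set (Euc n)} {W : Set (Euc n × Euc p)}
    (hW : ∀ z ∈ (Ω ×ˢ {θ : Euc p | θ ≠ 0}) ∩ closure W, z ∈ W) {B : Set (Euc n)}
    (hB : IsCompact B) (hBΩ : B ⊆ Ω) :
    IsCompact (W ∩ B ×ˢ Metric.sphere (0 : Euc p) 1) := by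
  have hC : IsCompact (B ×ˢ Metric.sphere (0 : Euc p) 1) := hB.prod (isCompact_sphere 0 1)
  have heq : W ∩ B ×ˢ Metric.sphere (0 : Euc p) 1 =
      closure W ∩ B ×ˢ Metric.sphere (0 : Euc p) 1 := by
    refine Subset.antisymm (inter_subset_inter_left _ subset_closure) fun z hz => ⟨?_, hz.2⟩
    exact hW z ⟨⟨hBΩ hz.2.1, ne_zero_of_mem_unit_sphere ⟨z.2, hz.2.2⟩⟩, hz.1⟩
  rw [heq]
  exact hC.inter_left isClosed_closure

/-- If no positive multiple of `v` is `w`, then the inner product of `v` with the direction of `w`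
is strictly smaller than the norm of `v`. -/
lemma inner_normalize_lt_norm {E : Type*} [NormedAddCommGroup E] [InnerProductSpace ℝ E]
    {v w : E} (hv : v ≠ 0) (hw : w ≠ 0) (h : ∀ t : ℝ, 0 < t → t • v ≠ w) :
    inner ℝ v (‖w‖⁻¹ • w) < ‖v‖ := by
  have he : ‖‖w‖⁻¹ • w‖ = 1 := norm_smul_inv_norm hw
  refine lt_of_le_of_ne (by simpa only [he, mul_one] using real_inner_le_norm v (‖w‖⁻¹ • w)) ?_
  intro heq
  have h1 := inner_eq_norm_mul_iff_real.1 (heq.trans (by rw [he, mul_one]) :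
    inner ℝ v (‖w‖⁻¹ • w) = ‖v‖ * ‖‖w‖⁻¹ • w‖)
  have hvn := norm_pos_iff.2 hv
  have hwn := norm_pos_iff.2 hw
  refine h (‖w‖ / ‖v‖) (div_pos hwn hvn) ?_
  rw [he, one_smul] at h1
  nth_rewrite 2 [h1]
  rw [smul_smul, smul_smul]
  field_simp
  simp

/-- classical phase functions, Remark on W_{φ,a}: if φ is a classical phase
function, W ⊆ C_φ = {∇_θφ = 0} is closed and conic, and (x₀,ξ₀) is not of the form
(y,∇_yφ(y,θ)) with (y,θ) ∈ W, then |ξ−∇_yφ(y,θ)| ≥ c(|ξ|+|θ|) on suitable neighborhoods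
U of x₀, Γ of ξ₀ and V of W. -/
theorem stmt19 {n p : ℕ} (Ω : Set (Euc n)) (hΩ : IsOpen Ω)
    (φ : Euc n × Euc p → ℝ)
    (hsm : ContDiffOn ℝ (⊤ : ℕ∞) φ (Ω ×ˢ {θ : Euc p | θ ≠ 0}))
    (hhom : ∀ y ∈ Ω, ∀ θ : Euc p, θ ≠ 0 → ∀ t : ℝ, 0 < t → φ (y, t • θ) = t * φ (y, θ))
    (hgrad : ∀ y ∈ Ω, ∀ θ : Euc p, θ ≠ 0 → gradSq φ (y, θ) ≠ 0)
    (W : Set (Euc n × Euc p))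
    (hWC : W ⊆ {z | z.1 ∈ Ω ∧ z.2 ≠ 0 ∧ gradXiSq φ z = 0})
    (hWclosed : ∀ z ∈ (Ω ×ˢ {θ : Euc p | θ ≠ 0}) ∩ closure W, z ∈ W)
    (hWcone : ∀ z ∈ W, ∀ t : ℝ, 0 < t → (z.1, t • z.2) ∈ W)
    (x₀ : Euc n) (hx₀ : x₀ ∈ Ω) (ξ₀ : Euc n) (hξ₀ : ξ₀ ≠ 0)
    (hnot : (x₀, ξ₀) ∉ {w : Euc n × Euc n | ∃ z ∈ W, w = (z.1, gradY φ z)}) :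
    ∃ U : Set (Euc n), IsOpen U ∧ x₀ ∈ U ∧ U ⊆ Ω ∧ IsCompact (closure U) ∧
    ∃ Γ : Set (Euc n), IsOpen Γ ∧ ξ₀ ∈ Γ ∧ (∀ ξ ∈ Γ, ξ ≠ (0 : Euc n)) ∧
      (∀ ξ ∈ Γ, ∀ t : ℝ, 0 < t → t • ξ ∈ Γ) ∧
    ∃ V : Set (Euc n × Euc p), W ⊆ V ∧ V ⊆ Ω ×ˢ {θ : Euc p | θ ≠ 0} ∧
      (∃ V' : Set (Euc n × Euc p), IsOpen V' ∧ V = V' ∩ (Ω ×ˢ {θ : Euc p | θ ≠ 0})) ∧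
      (∀ z ∈ V, ∀ t : ℝ, 0 < t → (z.1, t • z.2) ∈ V) ∧
    ∃ c > (0:ℝ), ∀ y ∈ U, ∀ ξ ∈ Γ, ∀ θ : Euc p, (y, θ) ∈ V →
      c * (‖ξ‖ + ‖θ‖) ≤ ‖ξ - gradY φ (y, θ)‖ := by
  set S : Set (Euc n × Euc p) := Ω ×ˢ {θ : Euc p | θ ≠ 0}
  have hSo : IsOpen S := isOpen_prod_ne_zero hΩ
  have hGc : ContinuousOn (gradY φ) S := continuousOn_gradY hSo hsm
  have hWS : W ⊆ S := fun z hz => ⟨(hWC hz).1, (hWC hz).2.1⟩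
  have hG0 : ∀ z ∈ W, gradY φ z ≠ 0 := fun z hz =>
    gradY_ne_zero (hgrad z.1 (hWC hz).1 z.2 (hWC hz).2.1) (hWC hz).2.2
  have hGsmul : ∀ z ∈ S, ∀ t : ℝ, 0 < t → gradY φ (z.1, t • z.2) = t • gradY φ z :=
    fun z hz t ht => gradY_smul hΩ hsm hhom hz.1 hz.2 ht
  set e : Euc n := ‖ξ₀‖⁻¹ • ξ₀ with he
  have he1 : ‖e‖ = 1 := norm_smul_inv_norm hξ₀
  have hξ₀n : 0 < ‖ξ₀‖ := norm_pos_iff.2 hξ₀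
  have hξ₀e : inner ℝ ξ₀ e = ‖ξ₀‖ := by
    rw [he, inner_smul_right, real_inner_self_eq_norm_sq]
    field_simp
  have hinner : ContinuousOn (fun z => inner ℝ (gradY φ z) e) S :=
    hGc.inner continuousOn_const
  obtain ⟨R, hR, hRΩ⟩ := Metric.nhds_basis_closedBall.mem_iff.1 (hΩ.mem_nhds hx₀)
  have hKR := isCompact_inter_prod_sphere hWclosed (isCompact_closedBall x₀ R) hRΩ
  obtain ⟨r, hr, hrR, hpos⟩ := exists_forall_closedBall_of_isCompact hKR
    (f := fun z => ‖gradY φ z‖ - inner ℝ (gradY φ z) e)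
    ((hGc.norm.sub hinner).mono (inter_subset_left.trans hWS)) (x₀ := x₀)
    (fun θ hθ => sub_pos.2 <| inner_normalize_lt_norm (hG0 _ hθ.1) hξ₀ fun t ht heq =>
      hnot ⟨(x₀, t • θ), hWcone _ hθ.1 t ht, by rw [hGsmul _ (hWS hθ.1) t ht, heq]⟩) hR
  have hrR' := Metric.closedBall_subset_closedBall hrR (x := x₀)
  set K : Set (Euc n × Euc p) := W ∩ Metric.closedBall x₀ r ×ˢ Metric.sphere (0 : Euc p) 1
  have hK : IsCompact K :=
    isCompact_inter_prod_sphere hWclosed (isCompact_closedBall x₀ r) (hrR'.trans hRΩ)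
  have hKS : K ⊆ S := inter_subset_left.trans hWS
  have hKpos : ∀ z ∈ K, inner ℝ (gradY φ z) e < ‖gradY φ z‖ := fun z hz =>
    sub_pos.1 (hpos z ⟨hz.1, hrR' hz.2.1, hz.2.2⟩ hz.2.1)
  obtain ⟨m, hm, hmK⟩ := hK.exists_forall_le' (hGc.norm.mono hKS)
    (fun z hz => norm_pos_iff.2 (hG0 z hz.1))
  obtain ⟨d₀, hd₀, hdK⟩ := hK.exists_forall_le'
    (f := fun z => 1 - inner ℝ (gradY φ z) e / ‖gradY φ z‖) (a := 0)
    (continuousOn_const.sub ((hinner.mono hKS).div (hGc.norm.mono hKS)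
      fun z hz => norm_ne_zero_iff.2 (hG0 z hz.1)))
    (fun z hz => sub_pos.2 ((div_lt_one (norm_pos_iff.2 (hG0 z hz.1))).2 (hKpos z hz)))
  obtain ⟨d, hd, hdd₀, hd1⟩ : ∃ d : ℝ, 0 < d ∧ d ≤ d₀ ∧ d ≤ 1 :=
    ⟨min d₀ 1, lt_min hd₀ one_pos, min_le_left _ _, min_le_right _ _⟩
  have hangle : ∀ z ∈ K, inner ℝ (gradY φ z) e < (1 - d / 2) * ‖gradY φ z‖ := by
    intro z hz
    have hn := norm_pos_iff.2 (hG0 z hz.1)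
    rw [← div_lt_iff₀ hn]
    linarith [hdK z hz]
  set P : Set (Euc n × Euc p) := {z | inner ℝ (gradY φ z) e < (1 - d / 2) * ‖gradY φ z‖ ∧
    m / 2 * ‖z.2‖ < ‖gradY φ z‖} with hP
  have hPcone : ∀ z ∈ S, ∀ t : ℝ, 0 < t → ((z.1, t • z.2) ∈ P ↔ z ∈ P) := by
    intro z hz t ht
    have h1 : (1 - d / 2) * (t * ‖gradY φ z‖) = t * ((1 - d / 2) * ‖gradY φ z‖) := by ring
    have h2 : m / 2 * (t * ‖z.2‖) = t * (m / 2 * ‖z.2‖) := by ring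
    simp only [hP, mem_ofPred_eq, hGsmul z hz t ht, real_inner_smul_left, norm_smul,
      Real.norm_of_nonneg ht.le, h1, h2, mul_lt_mul_iff_right₀ ht]
  have hPopen : IsOpen (S ∩ P) := by
    have h1 : IsOpen (S ∩ {z | inner ℝ (gradY φ z) e - (1 - d / 2) * ‖gradY φ z‖ < 0}) :=
      (hinner.sub (continuousOn_const.mul hGc.norm)).isOpen_inter_preimage hSo isOpen_Iio
    have h2 : IsOpen (S ∩ {z | m / 2 * ‖z.2‖ - ‖gradY φ z‖ < 0}) :=
      ((continuousOn_const.mul continuousOn_snd.norm).sub hGc.norm).isOpen_inter_preimage hSo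
        isOpen_Iio
    convert h1.inter h2 using 1
    ext z
    simp only [hP, mem_inter_iff, mem_ofPred_eq, sub_neg]
    tauto
  have hWP : ∀ z ∈ W, z.1 ∈ Metric.closedBall x₀ r → z ∈ P := by
    intro z hz hzr
    have hθ : 0 < ‖z.2‖ := norm_pos_iff.2 (hWS hz).2
    rw [← hPcone z (hWS hz) ‖z.2‖⁻¹ (inv_pos.2 hθ)]
    have hsph : ‖‖z.2‖⁻¹ • z.2‖ = 1 := norm_smul_inv_norm (hWS hz).2
    have hzK : (z.1, ‖z.2‖⁻¹ • z.2) ∈ K :=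
      ⟨hWcone z hz _ (inv_pos.2 hθ), hzr, mem_sphere_zero_iff_norm.2 hsph⟩
    refine ⟨hangle _ hzK, ?_⟩
    have := hmK _ hzK
    simp only [hsph]
    linarith
  refine ⟨Metric.ball x₀ r, Metric.isOpen_ball, Metric.mem_ball_self hr,
    Metric.ball_subset_closedBall.trans (hrR'.trans hRΩ),
    (isCompact_closedBall x₀ r).of_isClosed_subset isClosed_closure
      Metric.closure_ball_subset_closedBall,
    {ξ | (1 - d / 4) * ‖ξ‖ < inner ℝ ξ e}, ?_, ?_, ?_, ?_,
    S ∩ {z | z.1 ∉ Metric.closedBall x₀ r} ∪ S ∩ P, ?_, ?_, ?_, ?_, ?_⟩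
  · exact isOpen_lt (by fun_prop) (by fun_prop)
  · rw [mem_ofPred_eq, hξ₀e]
    nlinarith
  · rintro ξ hξ rfl
    simp at hξ
  · intro ξ hξ t ht
    rw [mem_ofPred_eq] at hξ ⊢
    rw [real_inner_smul_left, norm_smul, Real.norm_of_nonneg ht.le, mul_left_comm]
    exact mul_lt_mul_of_pos_left hξ ht
  · intro z hz
    by_cases hzr : z.1 ∈ Metric.closedBall x₀ r
    · exact Or.inr ⟨hWS hz, hWP z hz hzr⟩
    · exact Or.inl ⟨hWS hz, hzr⟩
  · exact union_subset inter_subset_left inter_subset_left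
  · refine ⟨_, (hSo.inter ((Metric.isClosed_closedBall (x := x₀) (ε := r)).isOpen_compl.preimage
      continuous_fst)).union hPopen, ?_⟩
    exact (inter_eq_left.2 (union_subset inter_subset_left inter_subset_left)).symm
  · have hScone : ∀ z ∈ S, ∀ t : ℝ, 0 < t → (z.1, t • z.2) ∈ S := fun z hz t ht =>
      ⟨hz.1, smul_ne_zero ht.ne' hz.2⟩
    rintro z (⟨hzS, hz⟩ | ⟨hzS, hz⟩) t ht
    · exact Or.inl ⟨hScone z hzS t ht, hz⟩
    · exact Or.inr ⟨hScone z hzS t ht, (hPcone z hzS t ht).2 hz⟩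
  · refine ⟨d / 16 * min 1 (m / 2), by positivity, fun y hy ξ hξ θ hz => ?_⟩
    rcases hz with ⟨-, hz⟩ | ⟨-, hzP, hzm⟩
    · exact absurd (Metric.ball_subset_closedBall hy) hz
    refine le_trans ?_ (mul_add_norm_le_norm_sub he1 (a := 1 - d / 2) (b := 1 - d / 4)
      (by linarith) (by linarith) (by linarith) (le_of_lt hξ) hzP.le)
    have h1 : min 1 (m / 2) * ‖ξ‖ ≤ 1 * ‖ξ‖ := by gcongr; exact min_le_left _ _
    have h2 : min 1 (m / 2) * ‖θ‖ ≤ m / 2 * ‖θ‖ := by gcongr; exact min_le_right _ _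
    have h3 : min 1 (m / 2) * (‖ξ‖ + ‖θ‖) ≤ ‖ξ‖ + ‖gradY φ (y, θ)‖ := by
      rw [mul_add]
      linarith
    calc d / 16 * min 1 (m / 2) * (‖ξ‖ + ‖θ‖)
        = d / 16 * (min 1 (m / 2) * (‖ξ‖ + ‖θ‖)) := by ring
      _ ≤ d / 16 * (‖ξ‖ + ‖gradY φ (y, θ)‖) := by gcongr
      _ = (1 - d / 4 - (1 - d / 2)) / 4 * (‖ξ‖ + ‖gradY φ (y, θ)‖) := by ring
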